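/- Suppose each C_i satisfies the (ε,δ)-lower deviation inequality and R ≥ (1−ε)Z. Then the mean-weighted allocation v = (R·μ_1/Z, …, R·μ_K/Z) has utilization U(v) ≥ (1−ε)(1−δ)Z ≥ (1−ε−δ)Z. -/

import Mathlib

open MeasureTheory ProbabilityTheory

/-- If a nonnegative random variable exceeds a level `a ≤ b` with probability at least `1 - δ`,
then its truncation at `b` has expectation at least `a * (1 - δ)`. -/
theorem mul_one_sub_le_integral_min {Ω : Type*} [MeasurableSpace Ω] {P : Measure Ω}
    [IsProbabilityMeasure P] {X : Ω → ℝ} (hX : Measurable X) (hint : Integrable X P)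
    (hnonneg : ∀ ω, 0 ≤ X ω) {a b δ : ℝ} (ha : 0 ≤ a) (hab : a ≤ b)
    (hδ : P.real {ω | X ω ≤ a} ≤ δ) :
    a * (1 - δ) ≤ ∫ ω, min (X ω) b ∂P := by
  have hs : MeasurableSet {ω | X ω ≤ a} := measurableSet_le hX measurable_const
  calc a * (1 - δ) ≤ a * P.real {ω | X ω ≤ a}ᶜ := by
        rw [probReal_compl_eq_one_sub hs]
        gcongr
    _ = ∫ ω, {ω | X ω ≤ a}ᶜ.indicator (fun _ => a) ω ∂P := by
        rw [integral_indicator_const a hs.compl, smul_eq_mul, mul_comm]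
    _ ≤ ∫ ω, min (X ω) b ∂P := by
        refine integral_mono ((integrable_const a).indicator hs.compl)
          (hint.inf (integrable_const b)) fun ω => ?_
        refine Set.indicator_apply_le' (fun h => ?_) fun _ => le_min (hnonneg ω) (ha.trans hab)
        have haX : a < X ω := by simpa using h
        exact le_min haX.le hab

/-- If each `C i` satisfies the `(ε,δ)`-lower deviation inequality and
`R ≥ (1-ε) Z`, then the mean-weighted allocation has utilization
`U(v) ≥ (1-ε)(1-δ) Z ≥ (1-ε-δ) Z`. -/
theorem meanWeighted_utilization_highR
    {Ω : Type*} [MeasureSpace Ω] [IsProbabilityMeasure (ℙ : Measure Ω)]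
    {K : ℕ} (hK : 0 < K)
    (C : Fin K → Ω → ℝ)
    (hmeas : ∀ i, Measurable (C i))
    (hint : ∀ i, Integrable (C i))
    (hnonneg : ∀ i, ∀ ω, 0 ≤ C i ω)
    (μ : Fin K → ℝ) (hμ : ∀ i, μ i = ∫ ω, C i ω) (hμpos : ∀ i, 0 < μ i)
    (ε δ : ℝ) (hε0 : 0 < ε) (hε1 : ε < 1) (hδ0 : 0 < δ) (hδ1 : δ < 1)
    (hLD : ∀ i, (ℙ {ω | C i ω ≤ (1 - ε) * μ i}).toReal ≤ δ)
    (R : ℝ) (hR : 0 < R)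
    (Z : ℝ) (hZ : Z = ∑ i, μ i)
    (hRZ : (1 - ε) * Z ≤ R)
    (v : Fin K → ℝ) (hv : ∀ i, v i = R * μ i / Z) :
    (1 - ε - δ) * Z ≤ (1 - ε) * (1 - δ) * Z ∧
    (1 - ε) * (1 - δ) * Z ≤ ∑ i, ∫ ω, min (C i ω) (v i) := by
  have hZpos : 0 < Z := by
    rw [hZ]
    exact Finset.sum_pos (fun i _ => hμpos i) ⟨⟨0, hK⟩, Finset.mem_univ _⟩
  constructor
  · gcongr
    nlinarith [mul_pos hε0 hδ0]
  · rw [hZ, Finset.mul_sum]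
    refine Finset.sum_le_sum fun i _ => ?_
    have hab : (1 - ε) * μ i ≤ v i := by
      rw [hv, le_div_iff₀ hZpos]
      nlinarith [mul_le_mul_of_nonneg_right hRZ (hμpos i).le]
    calc (1 - ε) * (1 - δ) * μ i = (1 - ε) * μ i * (1 - δ) := by ring
      _ ≤ _ := mul_one_sub_le_integral_min (hmeas i) (hint i) (hnonneg i)
          (mul_nonneg (sub_nonneg.mpr hε1.le) (hμpos i).le) hab (hLD i)
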